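/- There is a computable instance of HT^{=2}_2 with no Σ⁰₂ solution: there exists a computable coloring c : ℕ → Bool such that for every computable relation R : ℕ → ℕ → ℕ → Bool, if the set H = {n | ∃ a, ∀ b, R n a b = true} is infinite, then H is not a solution to c, i.e., there exist x, y, x', y' ∈ H with x ≠ y and x' ≠ y' such that c (x + y) ≠ c (x' + y'). -/

import Mathlib

/-- A set of naturals is `Lacunary` when its elements are positive and each is at least eight times
every smaller one. -/
def Lacunary (A : Finset ℕ) : Prop :=
  (∀ x ∈ A, 0 < x) ∧ ∀ x ∈ A, ∀ y ∈ A, x < y → 8 * x ≤ y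

theorem Lacunary.card_near_le_two {A : Finset ℕ} (hA : Lacunary A) (x : ℕ) :
    (A.filter fun y => y < 8 * x ∧ x < 8 * y).card ≤ 2 := by
  by_contra! h
  obtain ⟨a, ha, b, hb, c, hc, hab, hac, hbc⟩ := Finset.two_lt_card.1 h
  simp only [Finset.mem_filter] at ha hb hc
  have h1 := hA.2 a ha.1 b hb.1
  have h2 := hA.2 b hb.1 a ha.1
  have h3 := hA.2 a ha.1 c hc.1
  have h4 := hA.2 c hc.1 a ha.1
  have h5 := hA.2 b hb.1 c hc.1
  have h6 := hA.2 c hc.1 b hb.1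
  omega

theorem Lacunary.card_far {A : Finset ℕ} (hA : Lacunary A) (T : Finset ℕ) :
    A.card ≤ (A.filter fun y => ∀ x ∈ T, 8 * x ≤ y ∨ 8 * y ≤ x).card + T.card * 2 := by
  have hsub : A ⊆ (A.filter fun y => ∀ x ∈ T, 8 * x ≤ y ∨ 8 * y ≤ x) ∪
      T.biUnion fun x => A.filter fun y => y < 8 * x ∧ x < 8 * y := by
    intro y hy
    simp only [Finset.mem_union, Finset.mem_filter, Finset.mem_biUnion]
    by_cases h : ∀ x ∈ T, 8 * x ≤ y ∨ 8 * y ≤ x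
    · exact Or.inl ⟨hy, h⟩
    · push Not at h
      obtain ⟨x, hx, h1, h2⟩ := h
      exact Or.inr ⟨x, hx, hy, h1, h2⟩
  refine (Finset.card_le_card hsub).trans ((Finset.card_union_le _ _).trans ?_)
  exact Nat.add_le_add_left (Finset.card_biUnion_le_card_mul _ _ _
    fun x _ => hA.card_near_le_two x) _

/-- From large enough lacunary sets one can choose triples whose union is lacunary. -/
theorem exists_lacunary_transversal (A : ℕ → Finset ℕ) (r : ℕ)
    (hA : ∀ i < r, (A i).Nonempty → Lacunary (A i) ∧ 6 * i + 3 ≤ (A i).card) :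
    ∃ (T : Finset ℕ) (τ : ℕ → ℕ), T.card ≤ 3 * r ∧ Lacunary T ∧
      ∀ i < r, (A i).Nonempty → ∀ t < 3, ∃ x ∈ A i, x ∈ T ∧ τ x = t := by
  induction r with
  | zero => exact ⟨∅, id, by simp, by simp [Lacunary], by simp⟩
  | succ r ih =>
    obtain ⟨T, τ, hcard, hT, hτ⟩ := ih fun i hi => hA i (by omega)
    by_cases hne : (A r).Nonempty
    swap
    · refine ⟨T, τ, by omega, hT, fun i hi hi' => ?_⟩
      rcases Nat.lt_succ_iff_lt_or_eq.1 hi with h | rfl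
      · exact hτ i h hi'
      · exact absurd hi' hne
    obtain ⟨hlac, hbig⟩ := hA r (by omega) hne
    have hfar := hlac.card_far T
    obtain ⟨a, ha, b, hb, c, hc, hab, hac, hbc⟩ := Finset.two_lt_card.1
      (show 2 < ((A r).filter fun y => ∀ x ∈ T, 8 * x ≤ y ∨ 8 * y ≤ x).card by omega)
    simp only [Finset.mem_filter] at ha hb hc
    have hnot : ∀ y, (y ∈ A r ∧ ∀ x ∈ T, 8 * x ≤ y ∨ 8 * y ≤ x) → y ∉ T := fun y hy hyT => by
      have := hy.2 y hyT
      have := hlac.1 y hy.1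
      omega
    have haT := hnot a ha
    have hbT := hnot b hb
    have hcT := hnot c hc
    refine ⟨T ∪ {a, b, c}, fun n => if n ∈ T then τ n else if n = b then 1 else
      if n = c then 2 else 0, ?_, ⟨?_, ?_⟩, ?_⟩
    · have := Finset.card_union_le T {a, b, c}
      have := Finset.card_le_three (a := a) (b := b) (c := c)
      omega
    · intro x hx
      simp only [Finset.mem_union, Finset.mem_insert, Finset.mem_singleton] at hx
      rcases hx with hx | rfl | rfl | rfl
      · exact hT.1 x hx
      · exact hlac.1 _ ha.1
      · exact hlac.1 _ hb.1
      · exact hlac.1 _ hc.1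
    · have key : ∀ x ∈ T ∪ {a, b, c}, x ∈ T ∨ (x ∈ A r ∧ ∀ y ∈ T, 8 * y ≤ x ∨ 8 * x ≤ y) := by
        intro x hx
        simp only [Finset.mem_union, Finset.mem_insert, Finset.mem_singleton] at hx
        rcases hx with hx | rfl | rfl | rfl
        exacts [Or.inl hx, Or.inr ha, Or.inr hb, Or.inr hc]
      intro x hx y hy hxy
      rcases key x hx with hx | hx <;> rcases key y hy with hy | hy
      · exact hT.2 x hx y hy hxy
      · have := hy.2 x hx
        omega
      · have := hx.2 y hy
        omega
      · exact hlac.2 x hx.1 y hy.1 hxy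
    · intro i hi hi' t ht
      rcases Nat.lt_succ_iff_lt_or_eq.1 hi with h | rfl
      · obtain ⟨x, hx, hxT, hxt⟩ := hτ i h hi' t ht
        exact ⟨x, hx, by simp [hxT], by simp [hxT, hxt]⟩
      · interval_cases t
        · exact ⟨a, ha.1, by simp, by simp [haT, hab, hac]⟩
        · exact ⟨b, hb.1, by simp, by simp [hbT]⟩
        · exact ⟨c, hc.1, by simp, by simp [hcT, hbc.symm]⟩

/-- Multiples of a suitable angle by the elements of a lacunary set come close to prescribed
points of the circle. -/
theorem Lacunary.exists_angle {T : Finset ℕ} (hT : Lacunary T) (τ : ℕ → ℝ) :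
    ∃ θ : ℝ, ∀ x ∈ T, ∃ z : ℤ, |θ * x - z - τ x| ≤ 1 / 12 := by
  suffices H : ∃ θ₀ δ : ℝ, 0 < δ ∧ (∀ y : ℕ, 0 < y → (∀ x ∈ T, 8 * x ≤ y) → 7 / 6 ≤ δ * y) ∧
      ∀ θ, θ₀ ≤ θ → θ ≤ θ₀ + δ → ∀ x ∈ T, ∃ z : ℤ, |θ * x - z - τ x| ≤ 1 / 12 by
    obtain ⟨θ₀, δ, hδ, -, h⟩ := H
    exact ⟨θ₀, h θ₀ le_rfl (by linarith)⟩
  induction T using Finset.induction_on_max with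
  | empty =>
    refine ⟨0, 7 / 6, by norm_num, fun y hy _ => ?_, by simp⟩
    have : (1 : ℝ) ≤ y := by exact_mod_cast hy
    linarith
  | insert m T hm ih =>
    obtain ⟨θ₀, δ, hδ, hlarge, hgood⟩ := ih
      ⟨fun x hx => hT.1 x (by simp [hx]), fun x hx y hy => hT.2 x (by simp [hx]) y (by simp [hy])⟩
    have hm0 : (0 : ℝ) < m := by exact_mod_cast hT.1 m (by simp)
    have hδm := hlarge m (hT.1 m (by simp))
      fun x hx => hT.2 x (by simp [hx]) m (by simp) (hm x hx)
    set z : ℤ := ⌈θ₀ * m - τ m + 1 / 12⌉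
    have hz1 : θ₀ * m - τ m + 1 / 12 ≤ z := Int.le_ceil _
    have hz2 : (z : ℝ) < θ₀ * m - τ m + 1 / 12 + 1 := Int.ceil_lt_add_one _
    set θ₁ : ℝ := (z + τ m - 1 / 12) / m with hθ₁
    have hθ₁m : θ₁ * m = z + τ m - 1 / 12 := by rw [hθ₁]; field_simp
    have hδ₁m : 1 / (6 * m) * m = (1 / 6 : ℝ) := by field_simp
    have h01 : θ₀ ≤ θ₁ := le_of_mul_le_mul_right (by linarith) hm0
    have h11 : θ₁ + 1 / (6 * m) ≤ θ₀ + δ :=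
      le_of_mul_le_mul_right (by rw [add_mul, add_mul]; linarith) hm0
    refine ⟨θ₁, 1 / (6 * m), by positivity, fun y _ hy => ?_, fun θ h1 h2 x hx => ?_⟩
    · have : (8 * m : ℝ) ≤ y := by exact_mod_cast hy m (by simp)
      have h3 : 1 / (6 * m : ℝ) * (8 * m) ≤ 1 / (6 * m) * y := by gcongr
      have h4 : 1 / (6 * m : ℝ) * (8 * m) = 8 / 6 := by field_simp
      linarith
    · rcases Finset.mem_insert.1 hx with rfl | hx
      · refine ⟨z, abs_le.2 ⟨?_, ?_⟩⟩
        · have := mul_le_mul_of_nonneg_right h1 hm0.le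
          linarith
        · have := mul_le_mul_of_nonneg_right h2 hm0.le
          rw [add_mul] at this
          linarith
      · exact hgood θ (h01.trans h1) (h2.trans h11) x hx

/-- Three points of the circle near the vertices of an equilateral triangle are not in a common
half circle. -/
theorem not_all_in_half_circle {y₀ y₁ y₂ : ℝ} {w₀ w₁ w₂ : ℤ} {u ε₀ ε₁ ε₂ h : ℝ}
    (h₀ : |ε₀| ≤ 1 / 12) (h₁ : |ε₁| ≤ 1 / 12) (h₂ : |ε₂| ≤ 1 / 12)
    (e₀ : y₀ = u + ε₀) (e₁ : y₁ = u + 1 / 3 + ε₁) (e₂ : y₂ = u + 2 / 3 + ε₂)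
    (l₀ : w₀ + h ≤ y₀) (l₁ : w₁ + h ≤ y₁) (l₂ : w₂ + h ≤ y₂)
    (g₀ : y₀ < w₀ + h + 1 / 2) (g₁ : y₁ < w₁ + h + 1 / 2) (g₂ : y₂ < w₂ + h + 1 / 2) : False := by
  rw [abs_le] at h₀ h₁ h₂
  have a1 : (w₁ : ℝ) < w₀ + 1 := by linarith
  have a2 : (w₀ : ℝ) < w₁ + 1 := by linarith
  have b1 : (w₂ : ℝ) < w₁ + 1 := by linarith
  have b2 : (w₁ : ℝ) < w₂ + 1 := by linarith
  have a : w₀ = w₁ := by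
    have : w₁ < w₀ + 1 := by exact_mod_cast a1
    have : w₀ < w₁ + 1 := by exact_mod_cast a2
    omega
  have b : w₁ = w₂ := by
    have : w₂ < w₁ + 1 := by exact_mod_cast b1
    have : w₁ < w₂ + 1 := by exact_mod_cast b2
    omega
  subst a b
  linarith

/-- Large enough lacunary sets have a common two-coloring without monochromatic translates. -/
theorem exists_coloring_splitting_translates (A : ℕ → Finset ℕ) (r : ℕ)
    (hA : ∀ i < r, (A i).Nonempty → Lacunary (A i) ∧ 6 * i + 3 ≤ (A i).card) :
    ∃ f : ℕ → Bool, ∀ i < r, (A i).Nonempty → ∀ s, ∃ x ∈ A i, ∃ y ∈ A i, f (s + x) ≠ f (s + y) := by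
  obtain ⟨T, τ, -, hT, hτ⟩ := exists_lacunary_transversal A r hA
  obtain ⟨θ, hθ⟩ := hT.exists_angle fun n => (τ n : ℝ) / 3
  refine ⟨fun n => decide (Int.fract (θ * n) < 1 / 2), fun i hi hne s => ?_⟩
  obtain ⟨a, ha, haT, hat⟩ := hτ i hi hne 0 (by norm_num)
  obtain ⟨b, hb, hbT, hbt⟩ := hτ i hi hne 1 (by norm_num)
  obtain ⟨c, hc, hcT, hct⟩ := hτ i hi hne 2 (by norm_num)
  obtain ⟨za, hza⟩ := hθ a haT
  obtain ⟨zb, hzb⟩ := hθ b hbT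
  obtain ⟨zc, hzc⟩ := hθ c hcT
  simp only [hat, hbt, hct] at hza hzb hzc
  by_contra! hmono
  have hab := hmono a ha b hb
  have hac := hmono a ha c hc
  simp only [decide_eq_decide] at hab hac
  have hf : ∀ (n : ℕ) (z : ℤ), Int.fract (θ * (s + n : ℕ)) =
      θ * s + θ * n - z - (⌊θ * (s + n : ℕ)⌋ - z : ℤ) := fun n z => by
    rw [Int.fract]; push_cast; ring
  have h0 : ∀ n : ℕ, 0 ≤ Int.fract (θ * (s + n : ℕ)) := fun n => Int.fract_nonneg _
  have h1 : ∀ n : ℕ, Int.fract (θ * (s + n : ℕ)) < 1 := fun n => Int.fract_lt_one _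
  have ha0 := h0 a
  have hb0 := h0 b
  have hc0 := h0 c
  have ha1 := h1 a
  have hb1 := h1 b
  have hc1 := h1 c
  by_cases h : Int.fract (θ * (s + a : ℕ)) < 1 / 2
  · have hb2 := hab.1 h
    have hc2 := hac.1 h
    rw [hf a za] at *
    rw [hf b zb] at *
    rw [hf c zc] at *
    refine not_all_in_half_circle (u := θ * s) (h := 0) hza hzb hzc
      (y₀ := θ * s + θ * a - za) (y₁ := θ * s + θ * b - zb) (y₂ := θ * s + θ * c - zc)
      (w₀ := ⌊θ * (s + a : ℕ)⌋ - za) (w₁ := ⌊θ * (s + b : ℕ)⌋ - zb)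
      (w₂ := ⌊θ * (s + c : ℕ)⌋ - zc)
      ?_ ?_ ?_ ?_ ?_ ?_ ?_ ?_ ?_ <;> push_cast at * <;> linarith
  · have hb2 := mt hab.2 h
    have hc2 := mt hac.2 h
    rw [hf a za] at *
    rw [hf b zb] at *
    rw [hf c zc] at *
    refine not_all_in_half_circle (u := θ * s) (h := 1 / 2) hza hzb hzc
      (y₀ := θ * s + θ * a - za) (y₁ := θ * s + θ * b - zb) (y₂ := θ * s + θ * c - zc)
      (w₀ := ⌊θ * (s + a : ℕ)⌋ - za) (w₁ := ⌊θ * (s + b : ℕ)⌋ - zb)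
      (w₂ := ⌊θ * (s + c : ℕ)⌋ - zc)
      ?_ ?_ ?_ ?_ ?_ ?_ ?_ ?_ ?_ <;> push_cast at * <;> linarith

open Nat.Partrec Nat.Partrec.Code

/-- The `i`-th entry, an element of the set with its witness, of the finite list coded by `p`. -/
def entry (p i : ℕ) : ℕ × ℕ := (Denumerable.ofNat (List (ℕ × ℕ)) p).getD i (0, 0)

/-- The size of each of the two finite sets used against the `e`-th relation. -/
def quota (e : ℕ) : ℕ := 12 * e + 9

/-- The list coded by `p` starts with two successive lacunary blocks of elements which,
by stage `k`, still seem to belong to the `Σ⁰₂` set of index `e`. -/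
def Valid (e k p : ℕ) : Prop :=
  ∀ i < 2 * quota e, 0 < (entry p i).1 ∧ (∀ j < i, 8 * (entry p j).1 ≤ (entry p i).1) ∧
    ∀ b < k, evaln k (Denumerable.ofNat Code e)
      (Nat.pair (entry p i).1 (Nat.pair (entry p i).2 b)) ≠ some 0

/-- `p` is the least code valid at stage `k`. -/
def LeastValid (e k p : ℕ) : Prop := Valid e k p ∧ ∀ q < p, ¬ Valid e k q

/-- The `n`-th binary digit of `w`. -/
def bit (w n : ℕ) : ℕ := w / 2 ^ n % 2

/-- The binary digits of `w` are not constant on any translate below `L` of either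
block of the list coded by `p`. -/
def Splits (e w L p : ℕ) : Prop :=
  ∀ s < L, ∀ h < 2, s + (entry p (h * quota e + (quota e - 1))).1 < L →
    ∃ i < quota e, ∃ j < quota e,
      bit w (s + (entry p (h * quota e + i)).1) ≠ bit w (s + (entry p (h * quota e + j)).1)

/-- The binary digits of `w` meet the first `k` requirements, as approximated at stage `k`. -/
def Good (k w : ℕ) : Prop :=
  ∀ e < k, ∀ p < k, LeastValid e k p → Splits e w ((k + 1) * (k + 1)) p

section Primrec

variable {α : Type} [Primcodable α]

theorem PrimrecPred.forall_lt_param {f : α → ℕ} {P : α → ℕ → Prop} (hf : Primrec f)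
    (hP : PrimrecPred fun q : α × ℕ => P q.1 q.2) : PrimrecPred fun a => ∀ x < f a, P a x := by
  have h : PrimrecRel fun (x : ℕ) (a : α) => P a x := hP.comp (Primrec.snd.pair Primrec.fst)
  exact (h.forall_mem_list.comp (Primrec.list_range.comp hf) Primrec.id).of_eq (by simp)

theorem PrimrecPred.exists_lt_param {f : α → ℕ} {P : α → ℕ → Prop} (hf : Primrec f)
    (hP : PrimrecPred fun q : α × ℕ => P q.1 q.2) : PrimrecPred fun a => ∃ x < f a, P a x := by
  have h : PrimrecRel fun (x : ℕ) (a : α) => P a x := hP.comp (Primrec.snd.pair Primrec.fst)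
  exact (h.exists_mem_list.comp (Primrec.list_range.comp hf) Primrec.id).of_eq (by simp)

theorem PrimrecPred.imp {P Q : α → Prop} (hP : PrimrecPred P) (hQ : PrimrecPred Q) :
    PrimrecPred fun a => P a → Q a :=
  (hP.not.or hQ).of_eq fun _ => imp_iff_not_or.symm

theorem primrec_two_pow : Primrec fun n : ℕ => 2 ^ n :=
  (Primrec₂.unpaired'.1 Nat.Primrec.pow).comp (Primrec.const 2) Primrec.id

theorem primrec_entry {p i : α → ℕ} (hp : Primrec p) (hi : Primrec i) :
    Primrec fun a => entry (p a) (i a) :=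
  (Primrec.list_getD (0, 0)).comp ((Primrec.ofNat _).comp hp) hi

theorem primrec_quota {e : α → ℕ} (he : Primrec e) : Primrec fun a => quota (e a) :=
  Primrec.nat_add.comp (Primrec.nat_mul.comp (Primrec.const 12) he) (Primrec.const 9)

theorem primrec_bit {w n : α → ℕ} (hw : Primrec w) (hn : Primrec n) :
    Primrec fun a => bit (w a) (n a) :=
  Primrec.nat_mod.comp (Primrec.nat_div.comp hw (primrec_two_pow.comp hn)) (Primrec.const 2)

theorem primrecPred_valid {e k p : α → ℕ} (he : Primrec e) (hk : Primrec k) (hp : Primrec p) :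
    PrimrecPred fun a => Valid (e a) (k a) (p a) := by
  unfold Valid
  have hent : Primrec fun q : α × ℕ => entry (p q.1) q.2 :=
    primrec_entry (hp.comp Primrec.fst) Primrec.snd
  have hx := Primrec.fst.comp hent
  refine .forall_lt_param (Primrec.nat_mul.comp (Primrec.const 2) (primrec_quota he)) ?_
  refine (Primrec.nat_lt.comp (Primrec.const 0) hx).and (.and ?_ ?_)
  · refine .forall_lt_param Primrec.snd (Primrec.nat_le.comp ?_ (hx.comp Primrec.fst))
    exact Primrec.nat_mul.comp (Primrec.const 8) (Primrec.fst.comp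
      (primrec_entry (hp.comp (Primrec.fst.comp Primrec.fst)) Primrec.snd))
  · refine .forall_lt_param (hk.comp Primrec.fst) (PrimrecPred.not (Primrec.eq.comp ?_
      (Primrec.const _)))
    have hfst : Primrec fun q : (α × ℕ) × ℕ => q.1.1 := Primrec.fst.comp Primrec.fst
    exact primrec_evaln.comp ((((hk.comp hfst)).pair ((Primrec.ofNat Code).comp
      (he.comp hfst))).pair (Primrec₂.natPair.comp (hx.comp Primrec.fst)
      (Primrec₂.natPair.comp ((Primrec.snd.comp hent).comp Primrec.fst) Primrec.snd)))

theorem primrecPred_leastValid {e k p : α → ℕ} (he : Primrec e) (hk : Primrec k)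
    (hp : Primrec p) : PrimrecPred fun a => LeastValid (e a) (k a) (p a) :=
  (primrecPred_valid he hk hp).and (.forall_lt_param hp (PrimrecPred.not (primrecPred_valid
    (he.comp Primrec.fst) (hk.comp Primrec.fst) Primrec.snd)))

theorem primrecPred_splits {e w L p : α → ℕ} (he : Primrec e) (hw : Primrec w)
    (hL : Primrec L) (hp : Primrec p) :
    PrimrecPred fun a => Splits (e a) (w a) (L a) (p a) := by
  have hpoint : ∀ {β : Type} [Primcodable β] {a : β → α} {s h i : β → ℕ}, Primrec a →
      Primrec s → Primrec h → Primrec i → Primrec fun b =>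
        s b + (entry (p (a b)) (h b * quota (e (a b)) + i b)).1 := fun ha hs hh hi =>
    Primrec.nat_add.comp hs (Primrec.fst.comp (primrec_entry (hp.comp ha) (Primrec.nat_add.comp
      (Primrec.nat_mul.comp hh (primrec_quota (he.comp ha))) hi)))
  have h1 : Primrec fun q : (α × ℕ) × ℕ => q.1.1 := Primrec.fst.comp Primrec.fst
  have h2 : Primrec fun q : (α × ℕ) × ℕ => q.1.2 := Primrec.snd.comp Primrec.fst
  have hf : Primrec fun q : (((α × ℕ) × ℕ) × ℕ) × ℕ => q.1.1 := Primrec.fst.comp Primrec.fst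
  refine .forall_lt_param hL (.forall_lt_param (Primrec.const 2) (.imp ?_
    (.exists_lt_param (primrec_quota (he.comp h1)) (.exists_lt_param
      (primrec_quota (he.comp (h1.comp Primrec.fst))) (PrimrecPred.not (Primrec.eq.comp
        (primrec_bit (hw.comp (h1.comp hf)) ?_) (primrec_bit (hw.comp (h1.comp hf)) ?_)))))))
  · exact Primrec.nat_lt.comp (hpoint h1 h2 Primrec.snd (Primrec.nat_sub.comp
      (primrec_quota (he.comp h1)) (Primrec.const 1))) (hL.comp h1)
  · exact hpoint (h1.comp hf) (h2.comp hf) (Primrec.snd.comp hf) (Primrec.snd.comp Primrec.fst)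
  · exact hpoint (h1.comp hf) (h2.comp hf) (Primrec.snd.comp hf) Primrec.snd

theorem primrecRel_good : PrimrecRel Good := by
  have h1 : Primrec fun q : ((ℕ × ℕ) × ℕ) × ℕ => q.1.1.1 :=
    Primrec.fst.comp (Primrec.fst.comp Primrec.fst)
  have h2 : Primrec fun q : ((ℕ × ℕ) × ℕ) × ℕ => q.1.1.2 :=
    Primrec.snd.comp (Primrec.fst.comp Primrec.fst)
  have h3 : Primrec fun q : ((ℕ × ℕ) × ℕ) × ℕ => q.1.2 := Primrec.snd.comp Primrec.fst
  have hk := Primrec.succ.comp h1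
  exact .forall_lt_param Primrec.fst (.forall_lt_param (Primrec.fst.comp Primrec.fst)
    (.imp (primrecPred_leastValid h3 h1 Primrec.snd)
      (primrecPred_splits h3 h2 (Primrec.nat_mul.comp hk hk) Primrec.snd)))

end Primrec

open Classical in
/-- A good coloring of an initial segment of the naturals, coded in binary. -/
noncomputable def pattern (k : ℕ) : ℕ := (2 ^ ((k + 1) * (k + 1))).findGreatest (Good k)

/-- The coloring which on each interval between consecutive squares follows the pattern found
there. -/
noncomputable def coloring (n : ℕ) : Bool := decide (bit (pattern n.sqrt) n = 1)

theorem primrec_pattern : Primrec pattern := by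
  classical
  exact Primrec.nat_findGreatest (primrec_two_pow.comp
    (Primrec.nat_mul.comp Primrec.succ Primrec.succ)) primrecRel_good

theorem computable_coloring : Computable coloring := by
  have h : PrimrecPred fun n : ℕ => bit (pattern n.sqrt) n = 1 :=
    Primrec.eq.comp (primrec_bit (primrec_pattern.comp Primrec.nat_sqrt) Primrec.id)
      (Primrec.const 1)
  exact (primrecPred_iff_primrec_decide.1 h).to_comp

theorem coloring_ne {a b k : ℕ} (ha : a.sqrt = k) (hb : b.sqrt = k)
    (h : bit (pattern k) a ≠ bit (pattern k) b) : coloring a ≠ coloring b := by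
  rw [coloring, coloring, ha, hb, ne_eq, decide_eq_decide]
  have h1 : bit (pattern k) a < 2 := Nat.mod_lt _ two_pos
  have h2 : bit (pattern k) b < 2 := Nat.mod_lt _ two_pos
  omega

theorem Valid.mono {e k k' p : ℕ} (hk : k ≤ k') (h : Valid e k' p) : Valid e k p :=
  fun i hi => ⟨(h i hi).1, (h i hi).2.1, fun b hb h0 =>
    (h i hi).2.2 b (hb.trans_le hk) (evaln_mono hk h0)⟩

theorem Valid.lt_of_lt {e k p i j : ℕ} (h : Valid e k p) (hi : i < 2 * quota e) (hj : j < i) :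
    (entry p j).1 < (entry p i).1 := by
  have h1 := (h i hi).1
  have h2 := (h i hi).2.1 j hj
  omega

theorem Valid.le_of_le {e k p i j : ℕ} (h : Valid e k p) (hi : i < 2 * quota e) (hj : j ≤ i) :
    (entry p j).1 ≤ (entry p i).1 := by
  rcases hj.eq_or_lt with rfl | hj
  · rfl
  · exact (h.lt_of_lt hi hj).le

theorem LeastValid.unique {e k p q : ℕ} (hp : LeastValid e k p) (hq : LeastValid e k q) :
    p = q := by
  rcases lt_trichotomy p q with h | h | h
  · exact absurd hp.1 (hq.2 p h)
  · exact h
  · exact absurd hq.1 (hp.2 q h)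

/-- One of the two blocks of the list coded by `p`. -/
def block (e p h : ℕ) : Finset ℕ :=
  (Finset.range (quota e)).image fun i => (entry p (h * quota e + i)).1

theorem Valid.block_lacunary {e k p h : ℕ} (hp : Valid e k p) (hh : h < 2) :
    Lacunary (block e p h) ∧ (block e p h).card = quota e := by
  have hidx : ∀ i < quota e, h * quota e + i < 2 * quota e := fun i hi => by
    interval_cases h <;> omega
  have hlt : ∀ i < quota e, ∀ j < i,
      (entry p (h * quota e + j)).1 < (entry p (h * quota e + i)).1 := fun i hi j hj =>
    hp.lt_of_lt (hidx i hi) (by omega)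
  refine ⟨⟨?_, ?_⟩, ?_⟩
  · simp only [block, Finset.mem_image, Finset.mem_range]
    rintro _ ⟨i, hi, rfl⟩
    exact (hp _ (hidx i hi)).1
  · simp only [block, Finset.mem_image, Finset.mem_range]
    rintro _ ⟨i, hi, rfl⟩ _ ⟨j, hj, rfl⟩ hij
    refine (hp _ (hidx j hj)).2.1 _ ?_
    by_contra! hji
    exact absurd (hp.le_of_le (hidx i hi) hji) (by omega)
  · rw [block, Finset.card_image_of_injOn, Finset.card_range]
    intro i hi j hj hij
    simp only [Finset.coe_range, Set.mem_Iio] at hi hj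
    rcases lt_trichotomy i j with h' | h' | h'
    · exact absurd hij (hlt j hj i h').ne
    · exact h'
    · exact absurd hij (hlt i hi j h').ne'

theorem exists_bits (f : ℕ → Bool) (L : ℕ) :
    ∃ w < 2 ^ L, ∀ n < L, bit w n = (f n).toNat := by
  refine ⟨Nat.ofBits fun i : Fin L => f i, Nat.ofBits_lt_two_pow _, fun n hn => ?_⟩
  have h := Nat.testBit_ofBits_lt (fun i : Fin L => f i) n hn
  rw [Nat.testBit_eq_decide_div_mod_eq] at h
  rw [bit]
  have := Nat.mod_lt (Nat.ofBits (fun i : Fin L => f i) / 2 ^ n) two_pos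
  cases hf : f n <;> simp [hf] at h ⊢ <;> omega

theorem exists_good (k : ℕ) : ∃ w < 2 ^ ((k + 1) * (k + 1)), Good k w := by
  classical
  let A : ℕ → Finset ℕ := fun i =>
    if h : ∃ p, LeastValid (i / 2) k p then block (i / 2) h.choose (i % 2) else ∅
  have hA : ∀ {e p h : ℕ}, LeastValid e k p → h < 2 → A (2 * e + h) = block e p h := by
    intro e p h hp hh
    have h1 : (2 * e + h) / 2 = e := by omega
    have h2 : (2 * e + h) % 2 = h := by omega
    have hex : ∃ p, LeastValid e k p := ⟨p, hp⟩
    simp only [A, h1, h2, dif_pos hex, hex.choose_spec.unique hp]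
  obtain ⟨f, hf⟩ := exists_coloring_splitting_translates A (2 * k) fun i _ hne => by
    by_cases h : ∃ p, LeastValid (i / 2) k p
    · obtain ⟨p, hp⟩ := h
      have hi := hA hp (Nat.mod_lt i two_pos)
      rw [Nat.div_add_mod] at hi
      obtain ⟨h1, h2⟩ := hp.1.block_lacunary (Nat.mod_lt i two_pos)
      rw [hi, h2, quota]
      exact ⟨h1, by omega⟩
    · simp [A, h] at hne
  obtain ⟨w, hw, hbit⟩ := exists_bits f ((k + 1) * (k + 1))
  refine ⟨w, hw, fun e he p _ hp s _ h hh hL => ?_⟩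
  have hAe := hA hp hh
  have hq : 0 < quota e := by simp [quota]
  obtain ⟨x, hx, y, hy, hxy⟩ := hf (2 * e + h) (by omega)
    (by rw [hAe]; exact ⟨_, Finset.mem_image_of_mem _ (Finset.mem_range.2 hq)⟩) s
  rw [hAe] at hx hy
  simp only [block, Finset.mem_image, Finset.mem_range] at hx hy
  obtain ⟨i, hi, rfl⟩ := hx
  obtain ⟨j, hj, rfl⟩ := hy
  have hlast : ∀ i < quota e, s + (entry p (h * quota e + i)).1 < (k + 1) * (k + 1) := by
    intro i hi
    have := hp.1.le_of_le (i := h * quota e + (quota e - 1)) (j := h * quota e + i)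
      (by interval_cases h <;> omega) (by omega)
    omega
  refine ⟨i, hi, j, hj, ?_⟩
  rw [hbit _ (hlast i hi), hbit _ (hlast j hj)]
  intro heq
  apply hxy
  cases h1 : f (s + (entry p (h * quota e + i)).1) <;>
    cases h2 : f (s + (entry p (h * quota e + j)).1) <;> simp_all

theorem good_pattern (k : ℕ) : Good k (pattern k) := by
  classical
  obtain ⟨w, hw, hg⟩ := exists_good k
  exact Nat.findGreatest_spec hw.le hg

/-- An infinite set of naturals contains a sequence in which every term is positive and at least
eight times all the previous ones. -/
theorem Set.Infinite.exists_lacunary_seq {H : Set ℕ} (hH : H.Infinite) :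
    ∃ x : ℕ → ℕ, ∀ i, x i ∈ H ∧ 0 < x i ∧ ∀ j < i, 8 * x j ≤ x i := by
  choose g hg hlt using fun n => hH.exists_gt n
  let x : ℕ → ℕ := fun i => Nat.rec (g 0) (fun _ y => g (8 * y)) i
  have hs : ∀ i, 8 * x i < x (i + 1) := fun i => hlt _
  have hpos : ∀ i, 0 < x i := fun i => by
    cases i with
    | zero => exact hlt 0
    | succ i => exact (Nat.zero_le _).trans_lt (hs i)
  have hm : Monotone x := monotone_nat_of_le_succ fun i => by have := hs i; omega
  refine ⟨x, fun i => ⟨?_, hpos i, fun j hj => ?_⟩⟩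
  · cases i <;> exact hg _
  · obtain ⟨i, rfl⟩ : ∃ i', i = i' + 1 := ⟨i - 1, by omega⟩
    have := hs i
    have := hm (Nat.lt_succ_iff.1 hj)
    omega

theorem exists_index {R : ℕ → ℕ → ℕ → Bool}
    (hR : Computable fun p : ℕ × ℕ × ℕ => R p.1 p.2.1 p.2.2) :
    ∃ e, ∀ n a b v, (∃ k, evaln k (Denumerable.ofNat Code e) (Nat.pair n (Nat.pair a b)) = some v) ↔
      v = (R n a b).toNat := by
  obtain ⟨c, hc⟩ := exists_code.1 hR
  refine ⟨Encodable.encode c, fun n a b v => ?_⟩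
  rw [Denumerable.ofNat_encode]
  have h : eval c (Nat.pair n (Nat.pair a b)) = Part.some (R n a b).toNat := by
    rw [hc]
    have : Encodable.decode (α := ℕ × ℕ × ℕ) (Nat.pair n (Nat.pair a b)) = some (n, a, b) :=
      Encodable.encodek (n, a, b)
    change (Part.ofOption (Encodable.decode (α := ℕ × ℕ × ℕ)
      (Nat.pair n (Nat.pair a b)))).bind (fun p => Part.map Encodable.encode
        (Part.some (R p.1 p.2.1 p.2.2))) = _
    rw [this]
    cases hb : R n a b <;> simp [hb]
  have := evaln_complete (c := c) (n := Nat.pair n (Nat.pair a b)) (x := v)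
  rw [h, Part.mem_some_iff] at this
  exact this.symm

/-- The least valid code stabilizes, to a list of true elements of the set. -/
theorem exists_stable_code {R : ℕ → ℕ → ℕ → Bool}
    (hR : Computable fun p : ℕ × ℕ × ℕ => R p.1 p.2.1 p.2.2)
    (hH : {n : ℕ | ∃ a : ℕ, ∀ b : ℕ, R n a b = true}.Infinite) :
    ∃ e p K, (∀ k ≥ K, LeastValid e k p) ∧
      ∀ i < 2 * quota e, ∃ a, ∀ b, R (entry p i).1 a b = true := by
  classical
  obtain ⟨e, he⟩ := exists_index hR
  obtain ⟨x, hx⟩ := hH.exists_lacunary_seq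
  choose a ha using fun i => (hx i).1
  have hex : ∃ p, ∀ k, Valid e k p := by
    refine ⟨Encodable.encode ((List.range (2 * quota e)).map fun i => (x i, a i)), fun k i hi => ?_⟩
    have hent : ∀ j < 2 * quota e, entry (Encodable.encode
        ((List.range (2 * quota e)).map fun i => (x i, a i))) j = (x j, a j) := fun j hj => by
      rw [entry, Denumerable.ofNat_encode]
      simp [List.getD_eq_getElem?_getD, hj]
    rw [hent i hi]
    refine ⟨(hx i).2.1, fun j hj => ?_, fun b _ h0 => ?_⟩
    · rw [hent j (hj.trans hi)]
      exact (hx i).2.2 j hj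
    · have := (he _ _ _ _).1 ⟨k, h0⟩
      rw [ha i b] at this
      simp at this
  have hmin : ∀ q < Nat.find hex, ∃ k, ¬ Valid e k q := fun q hq => by
    simpa using Nat.find_min hex hq
  choose! κ hκ using hmin
  refine ⟨e, Nat.find hex, (Finset.range (Nat.find hex)).sup κ, fun k hk =>
    ⟨Nat.find_spec hex k, fun q hq hv => hκ q hq (hv.mono ?_)⟩, fun i hi => ⟨(entry (Nat.find hex) i).2, fun b => ?_⟩⟩
  · exact (Finset.le_sup (Finset.mem_range.2 hq)).trans hk
  · by_contra hb
    obtain ⟨k, hk⟩ := (he (entry (Nat.find hex) i).1 (entry (Nat.find hex) i).2 b 0).2 (by simp [hb])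
    exact (Nat.find_spec hex (max k (b + 1)) i hi).2.2 b (by omega)
      (evaln_mono (le_max_left _ _) hk)

/-- There is a computable instance of `HT^{=2}_2` with no `Σ⁰₂` solution: a computable
coloring `c` such that for every computable relation `R`, if `{n | ∃ a, ∀ b, R n a b}`
is infinite then it is not homogeneous for sums of two distinct elements under `c`. -/
theorem stmt_2 :
    ∃ c : ℕ → Bool, Computable c ∧
      ∀ R : ℕ → ℕ → ℕ → Bool,
        Computable (fun p : ℕ × ℕ × ℕ => R p.1 p.2.1 p.2.2) →
        {n : ℕ | ∃ a : ℕ, ∀ b : ℕ, R n a b = true}.Infinite →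
          ∃ x y x' y' : ℕ,
            (∃ a, ∀ b, R x a b = true) ∧ (∃ a, ∀ b, R y a b = true) ∧
            (∃ a, ∀ b, R x' a b = true) ∧ (∃ a, ∀ b, R y' a b = true) ∧
            x ≠ y ∧ x' ≠ y' ∧ c (x + y) ≠ c (x' + y') := by
  refine ⟨coloring, computable_coloring, fun R hR hH => ?_⟩
  obtain ⟨e, p, K, hstable, hmem⟩ := exists_stable_code hR hH
  set M := quota e with hM
  have hM0 : 0 < M := by simp [hM, quota]
  set D := (entry p (2 * M - 1)).1
  have hval : Valid e K p := (hstable K le_rfl).1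
  have hD : ∀ i < 2 * M, (entry p i).1 ≤ D := fun i hi => hval.le_of_le (by omega) (by omega)
  set B := K + D + e + p + 1
  obtain ⟨s, hs, hsB⟩ := hH.exists_gt (B * B)
  set k := s.sqrt
  have hBk : B ≤ k := Nat.le_sqrt.2 hsB.le
  have hks : k * k ≤ s := Nat.sqrt_le s
  have hsk : s < (k + 1) * (k + 1) := Nat.lt_succ_sqrt s
  have hDs : D < s := by
    have : B ≤ B * B := Nat.le_mul_self B
    omega
  have main : ∀ k' ≥ k, ∀ h < 2,
      (∀ i < M, k' * k' ≤ s + (entry p (h * M + i)).1 ∧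
        s + (entry p (h * M + i)).1 < (k' + 1) * (k' + 1)) →
      ∃ x y x' y' : ℕ,
        (∃ a, ∀ b, R x a b = true) ∧ (∃ a, ∀ b, R y a b = true) ∧
        (∃ a, ∀ b, R x' a b = true) ∧ (∃ a, ∀ b, R y' a b = true) ∧
        x ≠ y ∧ x' ≠ y' ∧ coloring (x + y) ≠ coloring (x' + y') := by
    intro k' hk' h hh hint
    have hidx : ∀ i < M, h * M + i < 2 * M := fun i hi => by interval_cases h <;> omega
    have hlast := (hint (M - 1) (by omega)).2
    obtain ⟨i, hi, j, hj, hij⟩ := good_pattern k' e (by omega) p (by omega)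
      (hstable k' (by omega)) s (by omega) h hh hlast
    have hsqrt : ∀ i < M, (s + (entry p (h * M + i)).1).sqrt = k' := fun i hi =>
      (Nat.eq_sqrt.2 (hint i hi)).symm
    have hi' := hD _ (hidx i hi)
    have hj' := hD _ (hidx j hj)
    exact ⟨s, _, s, _, hs, hmem _ (hidx i hi), hs, hmem _ (hidx j hj), by omega, by omega,
      coloring_ne (hsqrt i hi) (hsqrt j hj) hij⟩
  by_cases hc : s + (entry p (M - 1)).1 < (k + 1) * (k + 1)
  · refine main k le_rfl 0 two_pos fun i hi => ?_
    have := hval.le_of_le (i := M - 1) (j := 0 * M + i) (by omega) (by omega)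
    omega
  · refine main (k + 1) (by omega) 1 one_lt_two fun i hi => ⟨?_, ?_⟩
    · have := hval.le_of_le (i := 1 * M + i) (j := M - 1) (by omega) (by omega)
      omega
    · have := hD (1 * M + i) (by omega)
      have : D ≤ k := by omega
      nlinarith
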